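/- arXiv:1303.5188 — 2 statements merged into one kernel-verified Lean document; each statement's English description precedes it below -/
import Mathlib

section
/- If p ∤ r, then for M = [[−αr⁻¹, −εr⁻¹],[−r⁻¹, −αr⁻¹]] ∈ S one has τ_l(χ) = [G_l : T] · p^{2l} · μ(det M) · e(Tr M) · ψ(M), where χ = (μ∘det)·Ind_T^{G_l} ψ. (Theorem 3.3(2): Gauss sums for the degree-p^{l−1}(p−1) characters of G_l, l even, when p does not divide r.) -/
noncomputable section
open Matrix Complex

/-- The additive character `x ↦ ζ_N^{r·x} = exp(2πi·r·x/N)` of `ZMod N`. -/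
def aChar (N : ℕ) (r : ℤ) (x : ZMod N) : ℂ :=
  Complex.exp (2 * Real.pi * Complex.I * (r : ℂ) * (x.val : ℂ) / (N : ℂ))

/-- The Gauss sum `τ_l(χ) = Σ_{X ∈ GL₂(ℤ/N)} χ(X) e(Tr X)` with `e = aChar N r`. -/
def tauGL (N : ℕ) [NeZero N] (r : ℤ) (χ : GL (Fin 2) (ZMod N) → ℂ) : ℂ :=
  ∑ X : GL (Fin 2) (ZMod N), χ X * aChar N r (Matrix.trace X.val)

/-- `(Ind_H^T ψ)(g) = |H|⁻¹ Σ_{x ∈ T, x g x⁻¹ ∈ H} ψ(x g x⁻¹)`; induction to the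
full group is the case `T = Set.univ`. -/
def indC (N : ℕ) [NeZero N] (H T : Set (GL (Fin 2) (ZMod N)))
    (ψ : GL (Fin 2) (ZMod N) → ℂ) (g : GL (Fin 2) (ZMod N)) : ℂ :=
  (Nat.card H : ℂ)⁻¹ *
    ∑ x : GL (Fin 2) (ZMod N), T.indicator (fun y => H.indicator ψ (y * g * y⁻¹)) x

/-- The congruence set `K_k = {I + p^k B}` inside `GL₂(ℤ/p^l)`. -/
def Kset (p l k : ℕ) : Set (GL (Fin 2) (ZMod (p ^ l))) :=
  {X | ∃ B : Matrix (Fin 2) (Fin 2) (ZMod (p ^ l)),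
        X.val = 1 + ((p : ZMod (p ^ l)) ^ k) • B}

/-- `S = {[[a, εb],[b, a]]} ∩ GL₂(ℤ/p^l)`. -/
def Sset (p l ε : ℕ) : Set (GL (Fin 2) (ZMod (p ^ l))) :=
  {X | ∃ a b : ZMod (p ^ l), X.val = !![a, (ε : ZMod (p ^ l)) * b; b, a]}

/-- `T = K_m · S`. -/
def TKS (p l ε k : ℕ) : Set (GL (Fin 2) (ZMod (p ^ l))) :=
  {X | ∃ Y ∈ Kset p l k, ∃ Z ∈ Sset p l ε, X = Y * Z}

/-- `φ_A(X) = λ(Tr(A(X−I)))` with `λ = aChar (p^l) 1`. -/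
def phiA (p l : ℕ) (A : Matrix (Fin 2) (Fin 2) (ZMod (p ^ l)))
    (X : GL (Fin 2) (ZMod (p ^ l))) : ℂ :=
  aChar (p ^ l) 1 (Matrix.trace (A * (X.val - 1)))

section SquareZero

variable {R : Type*} [CommRing R]

/-- The unit `1 + q • B` of `M₂(R)` attached to a scalar `q` with `q * q = 0`. -/
def oneAddSmul (q : R) (hq : q * q = 0) (B : Matrix (Fin 2) (Fin 2) R) : GL (Fin 2) R where
  val := 1 + q • B
  inv := 1 - q • B
  val_inv := by
    have h : (q • B) * (q • B) = 0 := by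
      rw [Matrix.smul_mul, Matrix.mul_smul, smul_smul, hq, zero_smul]
    rw [mul_sub, mul_one, add_mul, one_mul, h, add_zero, add_sub_cancel_right]
  inv_val := by
    have h : (q • B) * (q • B) = 0 := by
      rw [Matrix.smul_mul, Matrix.mul_smul, smul_smul, hq, zero_smul]
    rw [mul_add, mul_one, sub_mul, one_mul, h, sub_zero, sub_add_cancel]

@[simp]
theorem oneAddSmul_val (q : R) (hq : q * q = 0) (B : Matrix (Fin 2) (Fin 2) R) :
    (oneAddSmul q hq B).val = 1 + q • B := rfl

theorem det_one_add_smul_of_sq_zero (q : R) (hq : q * q = 0) (B : Matrix (Fin 2) (Fin 2) R) :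
    (1 + q • B).det = 1 + q * B.trace := by
  simp only [Matrix.det_fin_two, Matrix.trace_fin_two, Matrix.add_apply, Matrix.smul_apply,
    smul_eq_mul, Matrix.one_apply_eq, Matrix.one_apply_ne (zero_ne_one (α := Fin 2)),
    Matrix.one_apply_ne (one_ne_zero (α := Fin 2))]
  linear_combination (B 0 0 * B 1 1 - B 0 1 * B 1 0) * hq

theorem isUnit_one_add_mul_of_sq_zero {q : R} (hq : q * q = 0) (x : R) : IsUnit (1 + q * x) :=
  IsUnit.of_mul_eq_one (1 - q * x) (by linear_combination -(x * x) * hq)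

end SquareZero

theorem card_matrix_smul_eq_zero {R : Type*} [CommRing R] (q : R) :
    Nat.card {D : Matrix (Fin 2) (Fin 2) R // q • D = 0} = Nat.card {d : R // q • d = 0} ^ 4 := by
  let e : {D : Matrix (Fin 2) (Fin 2) R // q • D = 0} ≃ (Fin 2 → Fin 2 → {d : R // q • d = 0}) :=
    { toFun := fun D i j => ⟨D.1 i j, congrFun (congrFun D.2 i) j⟩
      invFun := fun F => ⟨fun i j => (F i j).1, by ext i j; exact (F i j).2⟩
      left_inv := fun _ => rfl
      right_inv := fun _ => rfl }
  rw [Nat.card_congr e, Nat.card_fun, Nat.card_fun, Nat.card_fin, ← pow_mul]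

theorem aChar_eq_stdAddChar (N : ℕ) [NeZero N] (r : ℤ) (x : ZMod N) :
    aChar N r x = ZMod.stdAddChar ((r : ZMod N) * x) := by
  have h : ((r : ZMod N) * x) = ((r * (x.val : ℤ) : ℤ) : ZMod N) := by
    push_cast
    rw [ZMod.natCast_zmod_val]
  rw [h, ZMod.stdAddChar_coe, aChar]
  congr 1
  push_cast
  ring

/-- Orthogonality of the characters `B ↦ λ(Tr(D B))` of `M₂(ℤ/N)`. -/
theorem sum_stdAddChar_trace_mul (N : ℕ) [NeZero N] (D : Matrix (Fin 2) (Fin 2) (ZMod N)) :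
    ∑ B : Matrix (Fin 2) (Fin 2) (ZMod N), ZMod.stdAddChar (D * B).trace =
      if D = 0 then (Fintype.card (Matrix (Fin 2) (Fin 2) (ZMod N)) : ℂ) else 0 := by
  split_ifs with h
  · simp [h]
  · let Φ : AddChar (Matrix (Fin 2) (Fin 2) (ZMod N)) ℂ :=
      { toFun := fun B => ZMod.stdAddChar (D * B).trace
        map_zero_eq_one' := by simp
        map_add_eq_mul' := fun B C => by
          rw [Matrix.mul_add, Matrix.trace_add, AddChar.map_add_eq_mul] }
    refine AddChar.sum_eq_zero_of_ne_one (ψ := Φ) fun hΦ => h ?_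
    ext i j
    have h1 : ZMod.stdAddChar (D * Matrix.single j i (1 : ZMod N)).trace = (1 : ℂ) :=
      DFunLike.congr_fun hΦ (Matrix.single j i 1)
    rw [← AddChar.map_zero_eq_one (ZMod.stdAddChar (N := N))] at h1
    have h2 := ZMod.injective_stdAddChar h1
    rw [Matrix.trace_mul_single] at h2
    simpa using h2

/-- A function on `GL₂(ℤ/N)` transforming under `1 + q B` by `λ(u q Tr((Y - M) B))` has its whole
sum concentrated on the coset of `M`. -/
theorem sum_eq_of_apply_mul_oneAddSmul (N : ℕ) [NeZero N] (q u : ZMod N) (hq : q * q = 0)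
    (hu : IsUnit u) (hdiv : ∀ d : ZMod N, q * d = 0 → q ∣ d) (M : GL (Fin 2) (ZMod N))
    (f : GL (Fin 2) (ZMod N) → ℂ)
    (hf : ∀ Y B, f (Y * oneAddSmul q hq B) =
      f Y * ZMod.stdAddChar ((u * q) • (Y.val - M.val) * B).trace) :
    ∑ Y, f Y = (Nat.card {d : ZMod N // q • d = 0} : ℂ) ^ 4 * f M := by
  classical
  have hker : ∀ D : Matrix (Fin 2) (Fin 2) (ZMod N), (u * q) • D = 0 ↔ q • D = 0 := fun D => by
    rw [mul_smul]
    exact hu.smul_eq_zero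
  have hlift : ∀ D : Matrix (Fin 2) (Fin 2) (ZMod N), q • D = 0 → ∃ B, D = q • B := fun D hD => by
    have : ∀ i j, ∃ b, D i j = q * b := fun i j => hdiv _ (congrFun (congrFun hD i) j)
    choose B hB using this
    exact ⟨Matrix.of B, by ext i j; exact hB i j⟩
  have hcoset : ∀ D : Matrix (Fin 2) (Fin 2) (ZMod N), q • D = 0 →
      ∃ B, M.val + D = (M * oneAddSmul q hq B).val := fun D hD => by
    obtain ⟨B, rfl⟩ := hlift D hD
    refine ⟨M⁻¹.val * B, ?_⟩
    rw [Units.val_mul, oneAddSmul_val, Matrix.mul_add, Matrix.mul_one, Matrix.mul_smul,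
      ← Matrix.mul_assoc, ← Units.val_mul, mul_inv_cancel, Units.val_one, Matrix.one_mul]
  have hconst : ∀ Y : GL (Fin 2) (ZMod N), q • (Y.val - M.val) = 0 → f Y = f M := fun Y hY => by
    obtain ⟨B, hB⟩ := hcoset _ hY
    rw [add_sub_cancel] at hB
    rw [Units.ext hB, hf, sub_self, smul_zero, Matrix.zero_mul, Matrix.trace_zero,
      AddChar.map_zero_eq_one, mul_one]
  let e : {Y : GL (Fin 2) (ZMod N) // q • (Y.val - M.val) = 0} ≃
      {D : Matrix (Fin 2) (Fin 2) (ZMod N) // q • D = 0} :=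
    Equiv.ofBijective (fun Y => ⟨Y.1.val - M.val, Y.2⟩) (by
      constructor
      · intro Y Z h
        exact Subtype.ext (Units.ext (sub_left_injective (Subtype.ext_iff.mp h)))
      · rintro ⟨D, hD⟩
        obtain ⟨B, hB⟩ := hcoset D hD
        have h : (M * oneAddSmul q hq B).val - M.val = D := by rw [← hB, add_sub_cancel_left]
        exact ⟨⟨M * oneAddSmul q hq B, by rw [h, hD]⟩, Subtype.ext h⟩)
  set c : ℂ := (Fintype.card (Matrix (Fin 2) (Fin 2) (ZMod N)) : ℂ) with hc
  have hc0 : c ≠ 0 := Nat.cast_ne_zero.mpr Fintype.card_ne_zero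
  have key : c * ∑ Y, f Y = c * ∑ Y : GL (Fin 2) (ZMod N), if q • (Y.val - M.val) = 0 then f M else 0 := by
    calc c * ∑ Y, f Y
        = ∑ B : Matrix (Fin 2) (Fin 2) (ZMod N), ∑ Y, f (Y * oneAddSmul q hq B) := by
          rw [hc, ← nsmul_eq_mul, ← Finset.card_univ, ← Finset.sum_const]
          exact Finset.sum_congr rfl fun B _ =>
            (Equiv.sum_comp (Equiv.mulRight (oneAddSmul q hq B)) f).symm
      _ = ∑ Y : GL (Fin 2) (ZMod N), f Y * if q • (Y.val - M.val) = 0 then c else 0 := by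
          rw [Finset.sum_comm]
          refine Finset.sum_congr rfl fun Y _ => ?_
          simp only [hf, ← Finset.mul_sum, sum_stdAddChar_trace_mul, hker, hc]
      _ = _ := by
          rw [Finset.mul_sum]
          refine Finset.sum_congr rfl fun Y _ => ?_
          split_ifs with h
          · rw [hconst Y h, mul_comm]
          · simp
  rw [mul_left_cancel₀ hc0 key, ← Finset.sum_filter, Finset.sum_const, nsmul_eq_mul,
    ← Fintype.card_subtype, ← Nat.card_eq_fintype_card, Nat.card_congr e,
    card_matrix_smul_eq_zero]
  push_cast
  rfl

/-- The Gauss sum of `g · Ind ψ`, for a class function `g`, is a sum over the inducing set. -/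
theorem sum_mul_indC (N : ℕ) [NeZero N] (T : Set (GL (Fin 2) (ZMod N)))
    (ψ g : GL (Fin 2) (ZMod N) → ℂ) (hg : ∀ x X, g (x * X * x⁻¹) = g X) :
    ∑ X, g X * indC N T Set.univ ψ X =
      (Nat.card (GL (Fin 2) (ZMod N)) : ℂ) / (Nat.card T : ℂ) *
        ∑ Y, g Y * T.indicator ψ Y := by
  have h : ∀ x : GL (Fin 2) (ZMod N),
      ∑ X, g X * T.indicator ψ (x * X * x⁻¹) = ∑ Y, g Y * T.indicator ψ Y := fun x => by
    rw [← Equiv.sum_comp (MulAut.conj x).toEquiv fun Y => g Y * T.indicator ψ Y]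
    refine Finset.sum_congr rfl fun X _ => ?_
    simp only [MulEquiv.toEquiv_eq_coe, MulEquiv.coe_toEquiv, MulAut.conj_apply, hg]
  calc ∑ X, g X * indC N T Set.univ ψ X
      = (Nat.card T : ℂ)⁻¹ * ∑ x, ∑ X, g X * T.indicator ψ (x * X * x⁻¹) := by
        rw [Finset.sum_comm, Finset.mul_sum]
        refine Finset.sum_congr rfl fun X _ => ?_
        simp only [indC, Set.indicator_univ, Finset.mul_sum]
        refine Finset.sum_congr rfl fun x _ => ?_
        ring
    _ = _ := by
        simp only [h, Finset.sum_const, nsmul_eq_mul, Finset.card_univ, Nat.card_eq_fintype_card]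
        ring

theorem dvd_of_pow_mul_eq_zero (p m : ℕ) [Fact p.Prime] (d : ZMod (p ^ (2 * m)))
    (h : (p : ZMod (p ^ (2 * m))) ^ m * d = 0) : (p : ZMod (p ^ (2 * m))) ^ m ∣ d := by
  rw [← ZMod.natCast_zmod_val d] at h ⊢
  have h1 : ((p ^ m * d.val : ℕ) : ZMod (p ^ (2 * m))) = 0 := by exact_mod_cast h
  have h2 : p ^ m * p ^ m ∣ p ^ m * d.val := by
    rw [← pow_add, ← two_mul]
    exact (ZMod.natCast_eq_zero_iff _ _).mp h1
  obtain ⟨k, hk⟩ := Nat.dvd_of_mul_dvd_mul_left (pow_pos (Fact.out : p.Prime).pos m) h2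
  exact ⟨k, by exact_mod_cast congrArg (Nat.cast : ℕ → ZMod (p ^ (2 * m))) hk⟩

theorem card_pow_smul_eq_zero (p m : ℕ) [Fact p.Prime] :
    Nat.card {d : ZMod (p ^ (2 * m)) // (p : ZMod (p ^ (2 * m))) ^ m • d = 0} = p ^ m := by
  have h := IsAddCyclic.card_nsmulAddMonoidHom_ker (ZMod (p ^ (2 * m))) (p ^ m)
  rw [Nat.card_zmod, Nat.gcd_eq_right (pow_dvd_pow p (by omega))] at h
  rw [← h]
  refine Nat.card_congr (Equiv.subtypeEquivRight fun d => ?_)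
  rw [AddMonoidHom.mem_ker, nsmulAddMonoidHom_apply, nsmul_eq_mul, smul_eq_mul, Nat.cast_pow]

/-- A multiplicative function on units is determined on `1 + q ℤ/N` by its value at `1 + q`. -/
theorem apply_one_add_mul_of_sq_zero (N : ℕ) [NeZero N] (q a : ZMod N) (hq : q * q = 0)
    (μ : ZMod N → ℂ) (hμmul : ∀ x y, IsUnit x → IsUnit y → μ (x * y) = μ x * μ y)
    (hμne : ∀ x, IsUnit x → μ x ≠ 0) (hμ : μ (1 + q) = ZMod.stdAddChar (q * a)) (x : ZMod N) :
    μ (1 + q * x) = ZMod.stdAddChar (q * a * x) := by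
  have h1 : μ 1 = 1 := by
    have h := hμmul 1 1 isUnit_one isUnit_one
    rw [mul_one] at h
    exact mul_left_cancel₀ (hμne 1 isUnit_one) (by rw [← h, mul_one])
  have hnat : ∀ n : ℕ, μ (1 + q * n) = ZMod.stdAddChar (q * a * (n : ZMod N)) := fun n => by
    induction n with
    | zero => simp [h1]
    | succ n ih =>
      have h : 1 + q * ((n + 1 : ℕ) : ZMod N) = (1 + q * n) * (1 + q * 1) := by
        push_cast
        linear_combination -(n : ZMod N) * hq
      rw [h, hμmul _ _ (isUnit_one_add_mul_of_sq_zero hq _) (isUnit_one_add_mul_of_sq_zero hq _),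
        ih, mul_one, hμ, ← AddChar.map_add_eq_mul]
      congr 1
      push_cast
      ring
  simpa using hnat x.val

theorem Sset_subset_TKS (p l ε k : ℕ) : Sset p l ε ⊆ TKS p l ε k :=
  fun X hX => ⟨1, ⟨0, by simp⟩, X, hX, (one_mul X).symm⟩

theorem Kset_subset_TKS (p l ε k : ℕ) : Kset p l k ⊆ TKS p l ε k :=
  fun X hX => ⟨X, hX, 1, ⟨1, 0, by simp [Matrix.one_fin_two]⟩, (mul_one X).symm⟩

theorem oneAddSmul_mem_Kset (p l k : ℕ)
    (hq : (p : ZMod (p ^ l)) ^ k * (p : ZMod (p ^ l)) ^ k = 0)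
    (B : Matrix (Fin 2) (Fin 2) (ZMod (p ^ l))) :
    oneAddSmul ((p : ZMod (p ^ l)) ^ k) hq B ∈ Kset p l k := ⟨B, rfl⟩

theorem mul_oneAddSmul_mem_TKS (p l ε k : ℕ)
    (hq : (p : ZMod (p ^ l)) ^ k * (p : ZMod (p ^ l)) ^ k = 0)
    (B : Matrix (Fin 2) (Fin 2) (ZMod (p ^ l))) {Y : GL (Fin 2) (ZMod (p ^ l))}
    (hY : Y ∈ TKS p l ε k) :
    Y * oneAddSmul ((p : ZMod (p ^ l)) ^ k) hq B ∈ TKS p l ε k := by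
  obtain ⟨X, ⟨C, hC⟩, Z, hZ, rfl⟩ := hY
  refine ⟨X * (Z * oneAddSmul _ hq B * Z⁻¹), ?_, Z, hZ, by group⟩
  have hconj : (Z * oneAddSmul _ hq B * Z⁻¹).val =
      1 + ((p : ZMod (p ^ l)) ^ k) • (Z.val * B * Z⁻¹.val) := by
    rw [Units.val_mul, Units.val_mul, oneAddSmul_val, Matrix.mul_add, Matrix.add_mul,
      Matrix.mul_one, ← Units.val_mul, mul_inv_cancel, Units.val_one, Matrix.mul_smul,
      Matrix.smul_mul]
  refine ⟨C + (1 + ((p : ZMod (p ^ l)) ^ k) • C) * (Z.val * B * Z⁻¹.val), ?_⟩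
  rw [Units.val_mul, hC, hconj, Matrix.mul_add, Matrix.mul_one, Matrix.mul_smul, smul_add,
    add_assoc]

theorem mul_oneAddSmul_mem_TKS_iff (p l ε k : ℕ)
    (hq : (p : ZMod (p ^ l)) ^ k * (p : ZMod (p ^ l)) ^ k = 0)
    (B : Matrix (Fin 2) (Fin 2) (ZMod (p ^ l))) {Y : GL (Fin 2) (ZMod (p ^ l))} :
    Y * oneAddSmul ((p : ZMod (p ^ l)) ^ k) hq B ∈ TKS p l ε k ↔ Y ∈ TKS p l ε k := by
  refine ⟨fun h => ?_, mul_oneAddSmul_mem_TKS p l ε k hq B⟩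
  have hinv : oneAddSmul ((p : ZMod (p ^ l)) ^ k) hq B * oneAddSmul _ hq (-B) = 1 := by
    refine mul_eq_one_iff_eq_inv'.mpr (Units.ext ?_)
    change 1 + _ • -B = 1 - _ • B
    rw [smul_neg, sub_eq_add_neg]
  simpa only [mul_assoc, hinv, mul_one] using mul_oneAddSmul_mem_TKS p l ε k hq (-B) h

/-- Theorem 3.3(2): for `l = 2m` even, `χ = (μ∘det)·Ind_T^{G_l} ψ` of degree
`p^{l-1}(p-1)` and `p ∤ r`, with `M = [[−αr⁻¹, −εr⁻¹],[−r⁻¹, −αr⁻¹]] ∈ S` one has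
`τ_l(χ) = [G_l : T] · p^{2l} · μ(det M) · e(Tr M) · ψ(M)`. -/
theorem gauss_sum_X2_even (p m : ℕ) [Fact p.Prime] (hp : Odd p) (hm : 1 ≤ m)
    (r : ℤ) (hr : ¬ ((p : ℤ) ^ (2 * m) ∣ r)) (hpr : ¬ ((p : ℤ) ∣ r))
    (α ε : ℕ) (hα : α < p ^ m) (hε : ε < p ^ m) (hres : ¬ IsSquare (ε : ZMod p))
    (μ : ZMod (p ^ (2 * m)) → ℂ)
    (hμmul : ∀ x y : ZMod (p ^ (2 * m)), IsUnit x → IsUnit y → μ (x * y) = μ x * μ y)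
    (hμne : ∀ x : ZMod (p ^ (2 * m)), IsUnit x → μ x ≠ 0)
    (hμ : μ (1 + (p : ZMod (p ^ (2 * m))) ^ m) =
      aChar (p ^ (2 * m)) 1 ((p : ZMod (p ^ (2 * m))) ^ m * (α : ZMod (p ^ (2 * m)))))
    (ψ : GL (Fin 2) (ZMod (p ^ (2 * m))) → ℂ)
    (hψmul : ∀ X Y : GL (Fin 2) (ZMod (p ^ (2 * m))),
      X ∈ TKS p (2 * m) ε m → Y ∈ TKS p (2 * m) ε m → ψ (X * Y) = ψ X * ψ Y)
    (hψne : ∀ X ∈ TKS p (2 * m) ε m, ψ X ≠ 0)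
    (hψK : ∀ X ∈ Kset p (2 * m) m,
      ψ X = phiA p (2 * m) !![(0 : ZMod (p ^ (2 * m))), (ε : ZMod (p ^ (2 * m))); 1, 0] X)
    (M : GL (Fin 2) (ZMod (p ^ (2 * m))))
    (hM : M.val = !![-(α : ZMod (p ^ (2 * m))) * (r : ZMod (p ^ (2 * m)))⁻¹,
                     -(ε : ZMod (p ^ (2 * m))) * (r : ZMod (p ^ (2 * m)))⁻¹;
                     -(r : ZMod (p ^ (2 * m)))⁻¹,
                     -(α : ZMod (p ^ (2 * m))) * (r : ZMod (p ^ (2 * m)))⁻¹]) :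
    tauGL (p ^ (2 * m)) r
      (fun X => μ X.val.det * indC (p ^ (2 * m)) (TKS p (2 * m) ε m) Set.univ ψ X)
      = ((Nat.card (GL (Fin 2) (ZMod (p ^ (2 * m)))) : ℂ) /
          (Nat.card (TKS p (2 * m) ε m) : ℂ)) *
        (p : ℂ) ^ (2 * (2 * m)) * μ M.val.det *
        aChar (p ^ (2 * m)) r (Matrix.trace M.val) * ψ M := by
  set q : ZMod (p ^ (2 * m)) := (p : ZMod (p ^ (2 * m))) ^ m with hqdef
  have hq : q * q = 0 := by
    rw [hqdef, ← pow_add, ← two_mul]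
    exact_mod_cast ZMod.natCast_self (p ^ (2 * m))
  have hrr : (r : ZMod (p ^ (2 * m))) * (r : ZMod (p ^ (2 * m)))⁻¹ = 1 := by
    refine ZMod.coe_int_mul_inv_eq_one ?_
    push_cast
    exact (((Nat.prime_iff_prime_int.mp Fact.out).coprime_iff_not_dvd.mpr hpr).pow_left).symm
  have hru : IsUnit (r : ZMod (p ^ (2 * m))) := IsUnit.of_mul_eq_one _ hrr
  have hMT : M ∈ TKS p (2 * m) ε m :=
    Sset_subset_TKS _ _ _ _ ⟨_, -(r : ZMod (p ^ (2 * m)))⁻¹, by rw [hM, mul_neg, ← neg_mul]⟩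
  have hdet : ∀ X : GL (Fin 2) (ZMod (p ^ (2 * m))), IsUnit X.val.det := fun X =>
    (Matrix.isUnit_iff_isUnit_det _).mp X.isUnit
  simp only [aChar_eq_stdAddChar, Int.cast_one, one_mul, phiA] at hμ hψK ⊢
  set T := TKS p (2 * m) ε m with hT
  let g : GL (Fin 2) (ZMod (p ^ (2 * m))) → ℂ := fun X =>
    μ X.val.det * ZMod.stdAddChar ((r : ZMod (p ^ (2 * m))) * X.val.trace)
  have hg : ∀ x X, g (x * X * x⁻¹) = g X := fun x X => by
    have h1 : (x * X * x⁻¹).val.det = X.val.det := Matrix.det_units_conj x X.val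
    have h2 : (x * X * x⁻¹).val.trace = X.val.trace := Matrix.trace_units_conj x X.val
    simp only [g, h1, h2]
  have hf : ∀ Y B, g (Y * oneAddSmul q hq B) * T.indicator ψ (Y * oneAddSmul q hq B) =
      g Y * T.indicator ψ Y *
        ZMod.stdAddChar (((r : ZMod (p ^ (2 * m))) * q) • (Y.val - M.val) * B).trace := by
    intro Y B
    by_cases hY : Y ∈ T
    · have hYB := (mul_oneAddSmul_mem_TKS_iff p (2 * m) ε m hq B).mpr hY
      have hK := oneAddSmul_mem_Kset p (2 * m) m hq B
      have hdetB := det_one_add_smul_of_sq_zero q hq B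
      have hμB := apply_one_add_mul_of_sq_zero _ q _ hq μ hμmul hμne hμ B.trace
      rw [Set.indicator_of_mem hY, Set.indicator_of_mem hYB,
        hψmul _ _ hY (Kset_subset_TKS _ _ _ _ hK), hψK _ hK]
      simp only [g, Units.val_mul, oneAddSmul_val, Matrix.det_mul]
      rw [hdetB, hμmul _ _ (hdet Y) (isUnit_one_add_mul_of_sq_zero hq _), hμB,
        add_sub_cancel_left, Matrix.mul_add, Matrix.mul_one, Matrix.trace_add, mul_add,
        AddChar.map_add_eq_mul]
      have hphase : ((r * q) • (Y.val - M.val) * B).trace = q * α * B.trace +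
          r * (Y.val * q • B).trace +
          (!![(0 : ZMod (p ^ (2 * m))), (ε : ZMod (p ^ (2 * m))); 1, 0] * q • B).trace := by
        rw [hM]
        simp only [Matrix.trace_fin_two, Matrix.mul_apply, Fin.sum_univ_two, Matrix.smul_apply,
          Matrix.sub_apply, smul_eq_mul, Matrix.of_apply, Matrix.cons_val', Matrix.cons_val_zero,
          Matrix.cons_val_one, Matrix.cons_val_fin_one]
        linear_combination (q * α * (B 0 0 + B 1 1) + q * ε * B 1 0 + q * B 0 1) * hrr
      rw [hphase, AddChar.map_add_eq_mul, AddChar.map_add_eq_mul]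
      ring
    · have hYB := mt (mul_oneAddSmul_mem_TKS_iff p (2 * m) ε m hq B).mp hY
      rw [Set.indicator_of_notMem hY, Set.indicator_of_notMem hYB, mul_zero, mul_zero, zero_mul]
  have hsum := sum_eq_of_apply_mul_oneAddSmul _ q r hq hru (dvd_of_pow_mul_eq_zero p m) M
    (fun Y => g Y * T.indicator ψ Y) hf
  have hind := sum_mul_indC _ T ψ g hg
  rw [hsum, card_pow_smul_eq_zero, Set.indicator_of_mem hMT] at hind
  simp only [tauGL, aChar_eq_stdAddChar]
  calc _ = ∑ X, g X * indC (p ^ (2 * m)) T Set.univ ψ X :=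
        Finset.sum_congr rfl fun X _ => by simp only [g]; ring
    _ = _ := by
        rw [hind]
        simp only [g]
        push_cast
        ring
end
end

section
/- With φ′ = φ|_{N_{m+1}} one has the inner product identities ⟨Ind_{N_{m+1}}^{T} φ′, Ind_{N_{m+1}}^{T} φ′⟩_T = p²(p+1), ⟨Ind_{N_{m+1}}^{T} φ′, Ind_{L}^{T} φ⟩_T = p², and ⟨Ind_{L}^{T} φ, Ind_{L}^{T} φ⟩_T = p. (Inner-product computations from the proof of Lemma 3.4.) -/
noncomputable section
open Matrix Complex

/-- `N_{m+1} = {[[a, pεb+p^{m+1}c],[pb, a+p^{m+1}d]]} ∩ GL₂(ℤ/p^l)`. -/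
def NsetOdd (p l ε m : ℕ) : Set (GL (Fin 2) (ZMod (p ^ l))) :=
  {X | ∃ a b c d : ZMod (p ^ l),
    X.val = !![a, (p : ZMod (p ^ l)) * (ε : ZMod (p ^ l)) * b + (p : ZMod (p ^ l)) ^ (m + 1) * c;
               (p : ZMod (p ^ l)) * b, a + (p : ZMod (p ^ l)) ^ (m + 1) * d]}

/-- `⟨f, g⟩_T = |T|⁻¹ Σ_{x∈T} f(x)·conj(g(x))` for functions on `GL₂(ℤ/N)`. -/
def innerC (N : ℕ) [NeZero N] (T : Set (GL (Fin 2) (ZMod N)))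
    (f g : GL (Fin 2) (ZMod N) → ℂ) : ℂ :=
  (Nat.card T : ℂ)⁻¹ *
    ∑ x : GL (Fin 2) (ZMod N), T.indicator (fun y => f y * (starRingEnd ℂ) (g y)) x

section Characters

variable {N : ℕ} [NeZero N]

/-- If the `x ∈ T` carrying `g` into `H` are exactly those in `K`, and `ψ` is unchanged along them,
the induced function at `g` is a multiple of `ψ g`. -/
lemma indC_apply {H T K : Set (GL (Fin 2) (ZMod N))} {ψ : GL (Fin 2) (ZMod N) → ℂ}
    {g : GL (Fin 2) (ZMod N)} (hKT : K ⊆ T) (hK : ∀ x ∈ T, x * g * x⁻¹ ∈ H ↔ x ∈ K)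
    (hψ : ∀ x ∈ K, ψ (x * g * x⁻¹) = ψ g) :
    indC N H T ψ g = (Nat.card H : ℂ)⁻¹ * (Nat.card K * ψ g) := by
  classical
  have h : ∀ x, T.indicator (fun y => H.indicator ψ (y * g * y⁻¹)) x
      = if x ∈ K then ψ g else 0 := by
    intro x
    by_cases hx : x ∈ K
    · simp [Set.indicator, hKT hx, (hK x (hKT hx)).2 hx, hx, hψ x hx]
    · by_cases hT : x ∈ T
      · simp [Set.indicator, hT, hK x hT, hx]
      · simp [Set.indicator, hT, hx]
  simp_rw [indC, h, ← Finset.sum_filter, Finset.sum_const, nsmul_eq_mul]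
  rw [Nat.card_eq_fintype_card, Nat.card_eq_fintype_card, Fintype.card_subtype (· ∈ K)]

lemma indC_conj (H : Set (GL (Fin 2) (ZMod N))) (T : Subgroup (GL (Fin 2) (ZMod N)))
    (ψ : GL (Fin 2) (ZMod N) → ℂ) {y : GL (Fin 2) (ZMod N)} (hy : y ∈ T)
    (g : GL (Fin 2) (ZMod N)) :
    indC N H T ψ (y * g * y⁻¹) = indC N H T ψ g := by
  classical
  unfold indC
  congr 1
  rw [← Equiv.sum_comp (Equiv.mulRight y)
    (fun x => (T : Set _).indicator (fun y => H.indicator ψ (y * g * y⁻¹)) x)]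
  refine Finset.sum_congr rfl fun x _ => ?_
  simp [Set.indicator, T.mul_mem_cancel_right hy, mul_assoc]

/-- Frobenius reciprocity for a class function on `T`. -/
lemma innerC_indC {H T : Subgroup (GL (Fin 2) (ZMod N))} (hHT : H ≤ T)
    {f : GL (Fin 2) (ZMod N) → ℂ} (ψ : GL (Fin 2) (ZMod N) → ℂ)
    (hf : ∀ x ∈ T, ∀ g, f (x * g * x⁻¹) = f g) :
    innerC N T f (indC N H T ψ) = innerC N H f ψ := by
  classical
  have key : ∀ x ∈ T, ∑ g, (if g ∈ T then f g * (starRingEnd ℂ)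
      ((H : Set _).indicator ψ (x * g * x⁻¹)) else 0)
      = ∑ g, (H : Set _).indicator (fun g => f g * (starRingEnd ℂ) (ψ g)) g := by
    intro x hx
    rw [← (MulAut.conj x).toEquiv.sum_comp
      (fun g => (H : Set _).indicator (fun g => f g * (starRingEnd ℂ) (ψ g)) g)]
    refine Finset.sum_congr rfl fun g _ => ?_
    have hmem : x * g * x⁻¹ ∈ T ↔ g ∈ T := by
      rw [T.mul_mem_cancel_right (T.inv_mem hx), T.mul_mem_cancel_left hx]
    by_cases hg : x * g * x⁻¹ ∈ H
    · simp [Set.indicator, hg, hmem.1 (hHT hg), hf x hx]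
    · simp [Set.indicator, hg]
  have hT : (Nat.card T : ℂ) ≠ 0 := by exact_mod_cast Nat.card_pos.ne'
  have : ∀ g, (T : Set _).indicator
      (fun y => f y * (starRingEnd ℂ) (indC N H T ψ y)) g
      = (Nat.card H : ℂ)⁻¹ * ∑ x, if x ∈ T then (if g ∈ T then f g * (starRingEnd ℂ)
      ((H : Set _).indicator ψ (x * g * x⁻¹)) else 0) else 0 := by
    intro g
    by_cases hg : g ∈ T
    · simp only [Set.indicator, SetLike.mem_coe, hg, if_true, indC, map_mul, map_sum, map_inv₀,
        Complex.conj_natCast, Finset.mul_sum]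
      refine Finset.sum_congr (by rfl) fun x _ => ?_
      by_cases hx : x ∈ T
      · simp only [hx, if_true, SetLike.coe_sort_coe]
        ring
      · simp [hx]
    · simp [Set.indicator, hg]
  unfold innerC
  simp_rw [this]
  rw [← Finset.mul_sum, Finset.sum_comm]
  have h2 : ∀ x : GL (Fin 2) (ZMod N), (∑ g, if x ∈ T then (if g ∈ T then f g * (starRingEnd ℂ)
      ((H : Set _).indicator ψ (x * g * x⁻¹)) else 0) else 0)
      = if x ∈ T then ∑ g, (H : Set _).indicator (fun g => f g * (starRingEnd ℂ) (ψ g)) g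
        else 0 := by
    intro x
    split_ifs with hx
    · exact key x hx
    · simp
  simp_rw [h2]
  rw [← Finset.sum_filter, Finset.sum_const, nsmul_eq_mul, ← Fintype.card_subtype (· ∈ T),
    ← Nat.card_eq_fintype_card]
  simp only [SetLike.coe_sort_coe]
  field_simp

/-- A function multiplicative and nonvanishing on a subgroup is unitary there. -/
lemma mul_conj_eq_one_of_mul {L : Subgroup (GL (Fin 2) (ZMod N))}
    {φ : GL (Fin 2) (ZMod N) → ℂ} (hmul : ∀ x ∈ L, ∀ y ∈ L, φ (x * y) = φ x * φ y)
    (hne : ∀ x ∈ L, φ x ≠ 0) {g : GL (Fin 2) (ZMod N)} (hg : g ∈ L) :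
    φ g * (starRingEnd ℂ) (φ g) = 1 := by
  have h1 : φ 1 = 1 := by
    have := hmul 1 L.one_mem 1 L.one_mem
    rw [mul_one] at this
    exact (mul_eq_left₀ (hne 1 L.one_mem)).1 this.symm
  have hpow : ∀ n : ℕ, φ (g ^ n) = φ g ^ n := by
    intro n
    induction n with
    | zero => simpa using h1
    | succ k ih => rw [pow_succ, hmul _ (L.pow_mem hg k) _ hg, ih, pow_succ]
  have hn : ‖φ g‖ = 1 := by
    refine norm_eq_one_of_pow_eq_one (n := orderOf g) ?_ (orderOf_pos g).ne'
    rw [← hpow, pow_orderOf_eq_one, h1]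
  rw [Complex.mul_conj, Complex.normSq_eq_norm_sq, hn]
  simp

/-- Inner products of the characters induced from `φ` on `L` and from its restriction to a normal
subgroup `A` on which `φ` is `T`-stable, when `T` moves no element of `L` outside `A` back into `L`
except through `L`. -/
lemma innerC_indC_of_stable {A L T : Subgroup (GL (Fin 2) (ZMod N))} (hAL : A ≤ L) (hLT : L ≤ T)
    {φ : GL (Fin 2) (ZMod N) → ℂ} (hmul : ∀ x ∈ L, ∀ y ∈ L, φ (x * y) = φ x * φ y)
    (hne : ∀ x ∈ L, φ x ≠ 0) (hnorm : ∀ t ∈ T, ∀ x ∈ A, t * x * t⁻¹ ∈ A)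
    (hstab : ∀ t ∈ T, ∀ x ∈ A, φ (t * x * t⁻¹) = φ x)
    (hL : ∀ t ∈ T, ∀ x ∈ L, x ∉ A → t * x * t⁻¹ ∈ L → t ∈ L) :
    innerC N T (indC N A T φ) (indC N A T φ) = (Nat.card T : ℂ) / Nat.card A ∧
    innerC N T (indC N A T φ) (indC N L T φ) = (Nat.card T : ℂ) / Nat.card L ∧
    innerC N T (indC N L T φ) (indC N L T φ) = (Nat.card L : ℂ)⁻¹ *
      (Nat.card A * (Nat.card T / Nat.card L) + (Nat.card L - Nat.card A)) := by
  classical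
  have hT0 : (Nat.card T : ℂ) ≠ 0 := by exact_mod_cast Nat.card_pos.ne'
  have hL0 : (Nat.card L : ℂ) ≠ 0 := by exact_mod_cast Nat.card_pos.ne'
  have hA0 : (Nat.card A : ℂ) ≠ 0 := by exact_mod_cast Nat.card_pos.ne'
  have huni : ∀ g ∈ L, φ g * (starRingEnd ℂ) (φ g) = 1 := fun g hg =>
    mul_conj_eq_one_of_mul hmul hne hg
  have hcard : ∀ (H : Subgroup (GL (Fin 2) (ZMod N))) (c : ℂ),
      ∑ g, (if g ∈ H then c else 0) = Nat.card H * c := by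
    intro H c
    rw [← Finset.sum_filter, Finset.sum_const, nsmul_eq_mul, ← Fintype.card_subtype (· ∈ H),
      ← Nat.card_eq_fintype_card]
  have hAin : ∀ g ∈ A, indC N A T φ g = (Nat.card T : ℂ) / Nat.card A * φ g := by
    intro g hg
    rw [indC_apply (K := T) subset_rfl (fun x hx => iff_of_true (hnorm x hx g hg) hx)
      fun x hx => hstab x hx g hg]
    simp only [SetLike.coe_sort_coe]
    ring
  have hAout : ∀ g ∉ A, indC N A T φ g = 0 := by
    intro g hg
    rw [indC_apply (K := ∅) (by simp) (fun x hx => iff_of_false (fun h => hg ?_) (by simp))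
      (by simp)]
    · simp
    · simpa [mul_assoc] using hnorm x⁻¹ (T.inv_mem hx) _ h
  have hLin : ∀ g ∈ A, indC N L T φ g = (Nat.card T : ℂ) / Nat.card L * φ g := by
    intro g hg
    rw [indC_apply (K := T) subset_rfl (fun x hx => iff_of_true (hAL (hnorm x hx g hg)) hx)
      fun x hx => hstab x hx g hg]
    simp only [SetLike.coe_sort_coe]
    ring
  have hLout : ∀ g ∈ L, g ∉ A → indC N L T φ g = φ g := by
    intro g hg hgA
    rw [indC_apply (K := L) hLT (fun x hx => ⟨hL x hx g hg hgA, fun h =>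
      L.mul_mem (L.mul_mem h hg) (L.inv_mem h)⟩)]
    · simp only [SetLike.coe_sort_coe]
      field_simp
    · intro x hx
      have h1 := hmul _ (L.mul_mem (L.mul_mem hx hg) (L.inv_mem hx)) x hx
      rw [inv_mul_cancel_right, hmul x hx g hg, mul_comm] at h1
      exact (mul_right_cancel₀ (hne x hx) h1).symm
  refine ⟨?_, ?_, ?_⟩
  · rw [innerC_indC (hAL.trans hLT) φ fun x hx g => indC_conj _ T φ hx g]
    have : ∀ g, (A : Set _).indicator
        (fun y => indC N A T φ y * (starRingEnd ℂ) (φ y)) g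
        = if g ∈ A then (Nat.card T : ℂ) / Nat.card A else 0 := by
      intro g
      by_cases hg : g ∈ A
      · simp [Set.indicator, hg, hAin g hg, mul_assoc, huni g (hAL hg)]
      · simp [Set.indicator, hg]
    simp_rw [innerC, this, hcard]
    simp only [SetLike.coe_sort_coe]
    field_simp
  · rw [innerC_indC hLT φ fun x hx g => indC_conj _ T φ hx g]
    have : ∀ g, (L : Set _).indicator
        (fun y => indC N A T φ y * (starRingEnd ℂ) (φ y)) g
        = if g ∈ A then (Nat.card T : ℂ) / Nat.card A else 0 := by
      intro g
      by_cases hg : g ∈ A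
      · simp [Set.indicator, hg, hAL hg, hAin g hg, mul_assoc, huni g (hAL hg)]
      · simp [Set.indicator, hg, hAout g hg]
    simp_rw [innerC, this, hcard]
    simp only [SetLike.coe_sort_coe]
    field_simp
  · rw [innerC_indC hLT φ fun x hx g => indC_conj _ T φ hx g]
    have : ∀ g, (L : Set _).indicator
        (fun y => indC N L T φ y * (starRingEnd ℂ) (φ y)) g
        = (if g ∈ A then (Nat.card T : ℂ) / Nat.card L else 0) +
          ((if g ∈ L then 1 else 0) - if g ∈ A then 1 else 0) := by
      intro g
      by_cases hg : g ∈ A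
      · simp [Set.indicator, hg, hAL hg, hLin g hg, mul_assoc, huni g (hAL hg)]
      · by_cases hgL : g ∈ L
        · simp [Set.indicator, hg, hgL, hLout g hgL hg, huni g hgL]
        · simp [Set.indicator, hg, hgL]
    simp_rw [innerC, this, Finset.sum_add_distrib, Finset.sum_sub_distrib, hcard]
    simp

end Characters

section Commutators

variable {A : Type*} [Ring A]

lemma natCast_dvd_mul_left {n : ℕ} {x : A} (h : (n : A) ∣ x) (y : A) : (n : A) ∣ y * x := by
  obtain ⟨c, rfl⟩ := h
  exact ⟨y * c, by rw [← mul_assoc, ← mul_assoc, (Nat.cast_commute n y).eq]⟩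

lemma natCast_dvd_commutator {n : ℕ} {x : A} (h : (n : A) ∣ x) (y : A) :
    (n : A) ∣ x * y - y * x :=
  dvd_sub (h.mul_right y) (natCast_dvd_mul_left h y)

/-- The units commuting with `J` modulo `n`. -/
def commutingMod (n : ℕ) (J : A) : Subgroup Aˣ where
  carrier := {u | (n : A) ∣ u * J - J * u}
  one_mem' := by simp
  mul_mem' {u v} hu hv := by
    have h : ((u * v : Aˣ) : A) * J - J * (u * v : Aˣ) =
        u * (v * J - J * v) + (u * J - J * u) * v := by
      push_cast; noncomm_ring
    rw [Set.mem_ofPred_eq, h]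
    exact dvd_add (natCast_dvd_mul_left hv _) (hu.mul_right _)
  inv_mem' {u} hu := by
    have h : ((u⁻¹ : Aˣ) : A) * J - J * (u⁻¹ : Aˣ) =
        (u⁻¹ : Aˣ) * -((u * J - J * u) * (u⁻¹ : Aˣ)) := by
      simp [sub_mul, mul_sub, mul_assoc]
    rw [Set.mem_ofPred_eq, h]
    exact natCast_dvd_mul_left ((hu.mul_right _).neg_right) _

lemma mem_commutingMod {n : ℕ} {J : A} {u : Aˣ} :
    u ∈ commutingMod n J ↔ (n : A) ∣ u * J - J * u := Iff.rfl

lemma commutingMod_anti {n k : ℕ} (h : n ∣ k) (J : A) : commutingMod k J ≤ commutingMod n J :=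
  fun _ hu => (Nat.cast_dvd_cast h).trans hu

/-- The units of `commutingMod n J` that are central modulo `p`. -/
def commutingCentralMod (n p : ℕ) (J : A) : Subgroup Aˣ where
  carrier := {u | u ∈ commutingMod n J ∧ ∀ M, u ∈ commutingMod p M}
  one_mem' := ⟨one_mem _, fun _ => one_mem _⟩
  mul_mem' hu hv := ⟨mul_mem hu.1 hv.1, fun M => mul_mem (hu.2 M) (hv.2 M)⟩
  inv_mem' hu := ⟨inv_mem hu.1, fun M => inv_mem (hu.2 M)⟩

lemma mem_commutingCentralMod {n p : ℕ} {J : A} {u : Aˣ} :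
    u ∈ commutingCentralMod n p J ↔ u ∈ commutingMod n J ∧ ∀ M, u ∈ commutingMod p M := Iff.rfl

lemma conj_mem_commutingMod {n : ℕ} {J : A} {t u : Aˣ} :
    t * u * t⁻¹ ∈ commutingMod n J ↔ u ∈ commutingMod n ((t⁻¹ : Aˣ) * J * t) := by
  have h : ((t * u * t⁻¹ : Aˣ) : A) * J - J * (t * u * t⁻¹ : Aˣ) =
      t * (u * ((t⁻¹ : Aˣ) * J * t) - (t⁻¹ : Aˣ) * J * t * u) * (t⁻¹ : Aˣ) := by
    push_cast
    simp [sub_mul, mul_sub, mul_assoc]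
  rw [mem_commutingMod, mem_commutingMod, h]
  refine ⟨fun hd => ?_, fun hd => (natCast_dvd_mul_left hd _).mul_right _⟩
  simpa [mul_assoc] using (natCast_dvd_mul_left hd ((t⁻¹ : Aˣ) : A)).mul_right (t : A)

lemma exists_inv_mul_mul {n : ℕ} {J : A} {t : Aˣ} (ht : t ∈ commutingMod n J) :
    ∃ C, ((t⁻¹ : Aˣ) : A) * J * t = J + n * C := by
  obtain ⟨C, hC⟩ := inv_mem ht
  refine ⟨C * t, ?_⟩
  rw [← mul_assoc, ← hC]
  simp [sub_mul]

lemma conj_mem_commutingCentralMod {n p : ℕ} {J : A} {t u : Aˣ} (ht : t ∈ commutingMod n J)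
    (hu : u ∈ commutingCentralMod (n * p) p J) : t * u * t⁻¹ ∈ commutingCentralMod (n * p) p J := by
  refine ⟨?_, fun M => conj_mem_commutingMod.2 (hu.2 _)⟩
  obtain ⟨C, hC⟩ := exists_inv_mul_mul ht
  rw [conj_mem_commutingMod, hC, mem_commutingMod]
  have h : (u : A) * (J + n * C) - (J + n * C) * u = u * J - J * u + n * (u * C - C * u) := by
    have := (Nat.cast_commute n (u : A)).eq
    rw [mul_add, ← mul_assoc, ← this]
    noncomm_ring
  rw [h]
  refine dvd_add hu.1 ?_
  rw [Nat.cast_mul]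
  exact mul_dvd_mul_left _ (hu.2 C)

/-- Suppose `J ^ 2 = e` with `e` a natural number, `2 * e` is invertible modulo `p`, and `n` cancels
modulo `n * p`. If `t` commutes with `J` modulo `n` and conjugates some `u` into the units commuting
with `J` modulo `n * p`, where commuting with `u` modulo `p` implies commuting with `J` modulo `p`,
then `t` commutes with `J` modulo `n * p`. -/
lemma mem_commutingMod_of_conj_mem {n p e : ℕ} {J : A} (hJ : J * J = e) (hpn : p ∣ n)
    (hcop : Nat.Coprime (2 * e) p)
    (hcancel : ∀ x : A, ((n * p : ℕ) : A) ∣ n * x → (p : A) ∣ x) {t u : Aˣ}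
    (hu : u ∈ commutingMod (n * p) J)
    (huJ : ∀ C, (p : A) ∣ u * C - C * u → (p : A) ∣ J * C - C * J)
    (ht : t ∈ commutingMod n J) (htu : t * u * t⁻¹ ∈ commutingMod (n * p) J) :
    t ∈ commutingMod (n * p) J := by
  obtain ⟨C, hC⟩ := exists_inv_mul_mul ht
  rw [conj_mem_commutingMod, hC, mem_commutingMod] at htu
  have h1 : (p : A) ∣ J * C - C * J := by
    refine huJ C (hcancel _ ?_)
    have h : (n : A) * (u * C - C * u) =
        ((u : A) * (J + n * C) - (J + n * C) * u) - (u * J - J * u) := by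
      have := (Nat.cast_commute n (u : A)).eq
      rw [mul_add, ← mul_assoc (u : A), ← this]
      noncomm_ring
    rw [h]
    exact dvd_sub htu hu
  have hsq : (J + n * C) * (J + n * C) = e := by
    rw [← hC]
    simp only [mul_assoc, Units.mul_inv_cancel_left]
    rw [← mul_assoc J, hJ, (Nat.cast_commute e (t : A)).eq, Units.inv_mul_cancel_left]
  have h2 : (p : A) ∣ J * C + C * J := by
    refine hcancel _ ?_
    have h : (n : A) * (J * C + C * J) = -(n * (n * (C * C))) := by
      have hcJ := (Nat.cast_commute n J).eq
      have hcC := (Nat.cast_commute n C).eq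
      rw [← hJ] at hsq
      have h3 : n * (J * C + C * J) + n * (n * (C * C)) =
          (J + n * C) * (J + n * C) - J * J := by
        have hexp : (J + n * C) * (J + n * C) - J * J = J * n * C + n * C * J + n * (C * n) * C := by
          noncomm_ring
        rw [hexp, ← hcJ, ← hcC]
        noncomm_ring
      rw [hsq, sub_self] at h3
      exact eq_neg_of_add_eq_zero_left h3
    rw [h, Nat.cast_mul]
    exact (mul_dvd_mul_left _ ((Nat.cast_dvd_cast hpn).mul_right _)).neg_right
  have h3 : (p : A) ∣ ((2 * e : ℕ) : A) * C := by
    have h : ((2 * e : ℕ) : A) * C = J * ((J * C - C * J) + (J * C + C * J)) := by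
      have : J * ((J * C - C * J) + (J * C + C * J)) = 2 * ((J * J) * C) := by noncomm_ring
      rw [this, hJ]
      push_cast
      noncomm_ring
    rw [h]
    exact natCast_dvd_mul_left (dvd_add h1 h2) _
  have h4 : (p : A) ∣ C := by
    have hb : (1 : A) = ((2 * e : ℕ) : A) * ((Nat.gcdA (2 * e) p : ℤ) : A) +
        (p : A) * ((Nat.gcdB (2 * e) p : ℤ) : A) := by
      have := congrArg (Int.cast : ℤ → A) (Nat.gcd_eq_gcd_ab (2 * e) p)
      rw [hcop.gcd_eq_one] at this
      exact_mod_cast this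
    have hC1 : C = ((Nat.gcdA (2 * e) p : ℤ) : A) * (((2 * e : ℕ) : A) * C) +
        (p : A) * (((Nat.gcdB (2 * e) p : ℤ) : A) * C) := by
      rw [← mul_assoc, ← mul_assoc, ← add_mul, (Nat.cast_commute (2 * e) _).symm.eq, ← hb, one_mul]
    rw [hC1]
    exact dvd_add (natCast_dvd_mul_left h3 _) (dvd_mul_right _ _)
  have h5 : (t : A) * J - J * t = -(t * (n * C)) := by
    rw [eq_sub_of_add_eq' hC.symm]
    simp [mul_sub, mul_assoc]
  rw [mem_commutingMod, h5]
  refine (natCast_dvd_mul_left ?_ _).neg_right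
  rw [Nat.cast_mul]
  exact mul_dvd_mul_left _ h4

end Commutators

section Matrices

lemma Matrix.natCast_dvd_iff {n R : Type*} [Fintype n] [DecidableEq n] [Ring R] {k : ℕ}
    {M : Matrix n n R} : (k : Matrix n n R) ∣ M ↔ ∀ i j, (k : R) ∣ M i j := by
  have hk : ∀ (B : Matrix n n R) i j, ((k : Matrix n n R) * B) i j = k * B i j := by
    intro B i j
    rw [← nsmul_eq_mul, Matrix.smul_apply, nsmul_eq_mul]
  constructor
  · rintro ⟨B, rfl⟩ i j
    exact ⟨B i j, hk B i j⟩
  · intro h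
    choose B hB using h
    exact ⟨Matrix.of B, by ext i j; rw [hk, hB]; rfl⟩

lemma ZMod.natCast_dvd_natCast {N n : ℕ} (h : n ∣ N) {k : ℕ} :
    (n : ZMod N) ∣ (k : ZMod N) ↔ n ∣ k := by
  refine ⟨?_, fun hk => Nat.cast_dvd_cast hk⟩
  rintro ⟨c, hc⟩
  have := congrArg (ZMod.castHom h (ZMod n)) hc
  rw [map_mul, map_natCast, map_natCast, ZMod.natCast_self, zero_mul] at this
  exact (ZMod.natCast_eq_zero_iff k n).1 this

lemma ZMod.natCast_dvd_of_mul_dvd {N n k : ℕ} [NeZero N] (hn : n ≠ 0) (h : n * k ∣ N)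
    {x : ZMod N} (hx : ((n * k : ℕ) : ZMod N) ∣ n * x) : (k : ZMod N) ∣ x := by
  obtain ⟨y, rfl⟩ : ∃ y : ℕ, (y : ZMod N) = x := ⟨x.val, ZMod.natCast_zmod_val x⟩
  rw [← Nat.cast_mul, ZMod.natCast_dvd_natCast h] at hx
  exact Nat.cast_dvd_cast (Nat.dvd_of_mul_dvd_mul_left hn.bot_lt hx)

lemma ZMod.card_natCast_dvd {N n : ℕ} [NeZero N] (h : n ∣ N) :
    Nat.card {x : ZMod N // (n : ZMod N) ∣ x} = N / n := by
  have : ∀ x : ZMod N, (n : ZMod N) ∣ x ↔ x ∈ AddSubgroup.zmultiples (n : ZMod N) := by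
    intro x
    rw [AddSubgroup.mem_zmultiples_iff]
    constructor
    · rintro ⟨c, rfl⟩
      refine ⟨c.val, ?_⟩
      simp [mul_comm]
    · rintro ⟨z, rfl⟩
      exact ⟨z, by rw [zsmul_eq_mul, mul_comm]⟩
  simp_rw [this]
  change Nat.card (AddSubgroup.zmultiples (n : ZMod N)) = _
  rw [Nat.card_zmultiples, ZMod.addOrderOf_coe _ (NeZero.ne N), Nat.gcd_eq_right h]

/-- The matrix `A₀`. -/
abbrev rootMatrix (N ε : ℕ) : Matrix (Fin 2) (Fin 2) (ZMod N) := !![0, (ε : ZMod N); 1, 0]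

lemma rootMatrix_mul_self (N ε : ℕ) : rootMatrix N ε * rootMatrix N ε = (ε : Matrix _ _ _) := by
  rw [rootMatrix, Matrix.mul_fin_two, ← Matrix.diagonal_natCast]
  ext i j
  fin_cases i <;> fin_cases j <;> simp

lemma mem_commutingMod_rootMatrix {N ε n : ℕ} {u : GL (Fin 2) (ZMod N)} :
    u ∈ commutingMod n (rootMatrix N ε) ↔
      (n : ZMod N) ∣ u.val 0 1 - ε * u.val 1 0 ∧ (n : ZMod N) ∣ u.val 1 1 - u.val 0 0 := by
  have h : u.val * rootMatrix N ε - rootMatrix N ε * u.val =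
      !![u.val 0 1 - ε * u.val 1 0, -(ε * (u.val 1 1 - u.val 0 0));
        u.val 1 1 - u.val 0 0, -(u.val 0 1 - ε * u.val 1 0)] := by
    rw [Matrix.eta_fin_two u.val, rootMatrix, Matrix.mul_fin_two, Matrix.mul_fin_two]
    ext i j
    fin_cases i <;> fin_cases j <;> simp [mul_sub, mul_comm]
  rw [mem_commutingMod, h, Matrix.natCast_dvd_iff]
  constructor
  · intro h
    exact ⟨h 0 0, h 1 0⟩
  · rintro ⟨h1, h2⟩ i j
    fin_cases i <;> fin_cases j
    · exact h1
    · exact (h2.mul_left _).neg_right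
    · exact h2
    · exact h1.neg_right

lemma eq_add_of_mem_commutingMod_rootMatrix {N ε n : ℕ} {u : GL (Fin 2) (ZMod N)}
    (hu : u ∈ commutingMod n (rootMatrix N ε)) :
    ∃ D, u.val = u.val 0 0 • 1 + u.val 1 0 • rootMatrix N ε + n * D := by
  obtain ⟨⟨c, hc⟩, ⟨d, hd⟩⟩ := mem_commutingMod_rootMatrix.1 hu
  refine ⟨!![0, c; 0, d], ?_⟩
  rw [← nsmul_eq_mul]
  ext i j
  fin_cases i <;> fin_cases j <;> simp
  · linear_combination hc
  · linear_combination hd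

lemma commutator_of_mem_commutingMod_rootMatrix {N ε n : ℕ} {u : GL (Fin 2) (ZMod N)}
    (hu : u ∈ commutingMod n (rootMatrix N ε)) (C : Matrix (Fin 2) (Fin 2) (ZMod N)) :
    (n : Matrix _ _ _) ∣ (u.val * C - C * u.val) -
      u.val 1 0 • (rootMatrix N ε * C - C * rootMatrix N ε) := by
  obtain ⟨D, hD⟩ := eq_add_of_mem_commutingMod_rootMatrix hu
  have : (u.val * C - C * u.val) - u.val 1 0 • (rootMatrix N ε * C - C * rootMatrix N ε) =
      (n * D) * C - C * (n * D) := by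
    generalize hx : u.val 0 0 = x at *
    generalize hy : u.val 1 0 = y at *
    rw [hD]
    simp only [add_mul, mul_add, smul_mul_assoc, mul_smul_comm, one_mul, mul_one, smul_sub]
    abel
  rw [this]
  exact natCast_dvd_commutator (dvd_mul_right _ _) C

lemma mem_commutingCentralMod_rootMatrix {N ε n q : ℕ} (hqn : q ∣ n) {u : GL (Fin 2) (ZMod N)} :
    u ∈ commutingCentralMod n q (rootMatrix N ε) ↔
      u ∈ commutingMod n (rootMatrix N ε) ∧ (q : ZMod N) ∣ u.val 1 0 := by
  rw [mem_commutingCentralMod]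
  refine and_congr_right fun hu => ⟨fun h => ?_, fun h M => ?_⟩
  · have := Matrix.natCast_dvd_iff.1 (mem_commutingMod.1 (h !![1, 0; 0, 0])) 1 0
    rw [Matrix.eta_fin_two u.val, Matrix.mul_fin_two, Matrix.mul_fin_two] at this
    simpa using this
  · have h1 := (Nat.cast_dvd_cast hqn).trans (commutator_of_mem_commutingMod_rootMatrix hu M)
    have h2 : (q : Matrix (Fin 2) (Fin 2) (ZMod N)) ∣
        u.val 1 0 • (rootMatrix N ε * M - M * rootMatrix N ε) :=
      Matrix.natCast_dvd_iff.2 fun i j => h.mul_right _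
    rw [mem_commutingMod]
    simpa using dvd_add h1 h2

lemma NsetOdd_eq (p l ε m : ℕ) :
    NsetOdd p l ε m =
      (commutingCentralMod (p ^ (m + 1)) p (rootMatrix (p ^ l) ε) : Set (GL (Fin 2) _)) := by
  ext X
  rw [SetLike.mem_coe, mem_commutingCentralMod_rootMatrix (dvd_pow_self p (by simp)),
    mem_commutingMod_rootMatrix]
  constructor
  · rintro ⟨a, b, c, d, h⟩
    rw [h]
    refine ⟨⟨⟨c, ?_⟩, ⟨d, ?_⟩⟩, ⟨b, ?_⟩⟩ <;> simp
    ring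
  · rintro ⟨⟨⟨c, hc⟩, ⟨d, hd⟩⟩, ⟨b, hb⟩⟩
    refine ⟨X.val 0 0, b, c, d, ?_⟩
    push_cast at hc hd
    ext i j
    fin_cases i <;> fin_cases j <;> simp
    · linear_combination hc + ε * hb
    · exact hb
    · linear_combination hd

variable {p l : ℕ} [Fact p.Prime]

lemma ZMod.isUnit_iff_not_prime_dvd (hl : l ≠ 0) {x : ZMod (p ^ l)} :
    IsUnit x ↔ ¬ (p : ZMod (p ^ l)) ∣ x := by
  obtain ⟨y, rfl⟩ : ∃ y : ℕ, (y : ZMod (p ^ l)) = x := ⟨x.val, ZMod.natCast_zmod_val x⟩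
  rw [ZMod.isUnit_iff_coprime, Nat.coprime_pow_right_iff hl.bot_lt,
    ZMod.natCast_dvd_natCast (dvd_pow_self p hl), Nat.coprime_comm,
    (Fact.out : p.Prime).coprime_iff_not_dvd]

lemma ZMod.prime_dvd_sq_sub_iff (hl : l ≠ 0) {ε : ℕ} (hres : ¬ IsSquare (ε : ZMod p))
    {a b : ZMod (p ^ l)} :
    (p : ZMod (p ^ l)) ∣ a * a - ε * (b * b) ↔ (p : ZMod (p ^ l)) ∣ a ∧ (p : ZMod (p ^ l)) ∣ b := by
  have hpl := dvd_pow_self p hl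
  have key : ∀ x : ZMod (p ^ l), (p : ZMod (p ^ l)) ∣ x ↔ ZMod.castHom hpl (ZMod p) x = 0 := by
    intro x
    obtain ⟨y, rfl⟩ : ∃ y : ℕ, (y : ZMod (p ^ l)) = x := ⟨x.val, ZMod.natCast_zmod_val x⟩
    rw [ZMod.natCast_dvd_natCast hpl, map_natCast, ZMod.natCast_eq_zero_iff]
  simp only [key, map_sub, map_mul, map_natCast]
  constructor
  · intro h
    have hb : ZMod.castHom hpl (ZMod p) b = 0 := by
      by_contra hb
      refine hres ⟨ZMod.castHom hpl (ZMod p) a / ZMod.castHom hpl (ZMod p) b, ?_⟩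
      field_simp
      linear_combination -h
    rw [hb] at h ⊢
    simpa using h
  · rintro ⟨ha, hb⟩
    simp [ha, hb]

variable {ε : ℕ}

lemma isUnit_det_iff (hl : l ≠ 0) (hres : ¬ IsSquare (ε : ZMod p)) {n : ℕ} (hn : p ∣ n)
    {M : Matrix (Fin 2) (Fin 2) (ZMod (p ^ l))}
    (h1 : (n : ZMod (p ^ l)) ∣ M 0 1 - ε * M 1 0) (h2 : (n : ZMod (p ^ l)) ∣ M 1 1 - M 0 0) :
    IsUnit M.det ↔ ¬ ((p : ZMod (p ^ l)) ∣ M 0 0 ∧ (p : ZMod (p ^ l)) ∣ M 1 0) := by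
  have hpn : (p : ZMod (p ^ l)) ∣ n := Nat.cast_dvd_cast hn
  have h : M.det = (M 0 0 * M 0 0 - ε * (M 1 0 * M 1 0)) +
      (M 0 0 * (M 1 1 - M 0 0) - M 1 0 * (M 0 1 - ε * M 1 0)) := by
    rw [Matrix.det_fin_two]
    ring
  rw [ZMod.isUnit_iff_not_prime_dvd hl, h, dvd_add_left, ZMod.prime_dvd_sq_sub_iff hl hres]
  exact dvd_sub ((hpn.trans h2).mul_left _) ((hpn.trans h1).mul_left _)

lemma TKS_eq (hl : l ≠ 0) (hres : ¬ IsSquare (ε : ZMod p)) {k : ℕ} (hk : k ≠ 0) :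
    TKS p l ε k = (commutingMod (p ^ k) (rootMatrix (p ^ l) ε) : Set (GL (Fin 2) _)) := by
  have hpk : p ∣ p ^ k := dvd_pow_self p hk
  ext X
  rw [SetLike.mem_coe]
  constructor
  · rintro ⟨Y, ⟨B, hB⟩, Z, ⟨a, b, hZ⟩, rfl⟩
    refine mul_mem (mem_commutingMod_rootMatrix.2 ?_) (mem_commutingMod_rootMatrix.2 ?_)
    · rw [hB]
      constructor
      · exact ⟨B 0 1 - ε * B 1 0, by simp; ring⟩
      · exact ⟨B 1 1 - B 0 0, by simp; ring⟩
    · simp [hZ]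
  · intro hX
    obtain ⟨h1, h2⟩ := mem_commutingMod_rootMatrix.1 hX
    set M : Matrix (Fin 2) (Fin 2) (ZMod (p ^ l)) :=
      !![X.val 0 0, ε * X.val 1 0; X.val 1 0, X.val 0 0] with hM
    have hXu : IsUnit X.val.det := (Matrix.isUnit_iff_isUnit_det _).1 X.isUnit
    have hMu : IsUnit M.det := by
      rw [isUnit_det_iff hl hres hpk (by simp [hM]) (by simp [hM])]
      simpa [hM] using (isUnit_det_iff hl hres hpk h1 h2).1 hXu
    obtain ⟨D, hD⟩ := eq_add_of_mem_commutingMod_rootMatrix hX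
    let Z := Matrix.GeneralLinearGroup.mk'' M hMu
    have hZ : Z.val = M := rfl
    have hXZ : X.val = Z.val + ((p ^ k : ℕ) : Matrix _ _ _) * D := by
      rw [hD, hZ, hM]
      congr 1
      ext i j
      fin_cases i <;> fin_cases j <;> simp [mul_comm]
    refine ⟨X * Z⁻¹, ⟨D * (Z⁻¹).val, ?_⟩, Z, ⟨_, _, rfl⟩, by simp⟩
    rw [Units.val_mul, hXZ, add_mul, Units.mul_inv, mul_assoc, ← nsmul_eq_mul,
      ← Nat.cast_smul_eq_nsmul (ZMod (p ^ l))]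
    push_cast
    rfl

/-- Units commuting with `rootMatrix` modulo `n` are determined by their first column and two
free multiples of `n`. -/
lemma card_commutingMod_and (hl : l ≠ 0) (hres : ¬ IsSquare (ε : ZMod p)) {n : ℕ} (hn : p ∣ n)
    (Q : ZMod (p ^ l) → Prop) :
    Nat.card {u : GL (Fin 2) (ZMod (p ^ l)) //
        u ∈ commutingMod n (rootMatrix (p ^ l) ε) ∧ Q (u.val 1 0)} =
      Nat.card {c : ZMod (p ^ l) × ZMod (p ^ l) //
        ¬ ((p : ZMod (p ^ l)) ∣ c.1 ∧ (p : ZMod (p ^ l)) ∣ c.2) ∧ Q c.2} *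
      (Nat.card {x : ZMod (p ^ l) // (n : ZMod (p ^ l)) ∣ x}) ^ 2 := by
  have hdet : ∀ u : GL (Fin 2) (ZMod (p ^ l)), IsUnit u.val.det := fun u =>
    (Matrix.isUnit_iff_isUnit_det _).1 u.isUnit
  rw [sq, ← Nat.card_prod, ← Nat.card_prod]
  refine Nat.card_congr
    { toFun u := ⟨⟨(u.1.val 0 0, u.1.val 1 0), ?_, u.2.2⟩,
        ⟨u.1.val 0 1 - ε * u.1.val 1 0, (mem_commutingMod_rootMatrix.1 u.2.1).1⟩,
        ⟨u.1.val 1 1 - u.1.val 0 0, (mem_commutingMod_rootMatrix.1 u.2.1).2⟩⟩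
      invFun c := ⟨Matrix.GeneralLinearGroup.mk''
        !![c.1.1.1, ε * c.1.1.2 + c.2.1; c.1.1.2, c.1.1.1 + c.2.2] ?_, ?_, ?_⟩
      left_inv u := ?_
      right_inv c := ?_ }
  · exact (isUnit_det_iff hl hres hn (mem_commutingMod_rootMatrix.1 u.2.1).1
      (mem_commutingMod_rootMatrix.1 u.2.1).2).1 (hdet u.1)
  · exact (isUnit_det_iff hl hres hn (by simpa using c.2.1.2) (by simpa using c.2.2.2)).2 c.1.2.1
  · rw [mem_commutingMod_rootMatrix]
    exact ⟨by simpa using c.2.1.2, by simpa using c.2.2.2⟩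
  · exact c.1.2.2
  · ext i j
    fin_cases i <;> fin_cases j <;> simp
  · ext <;> simp

end Matrices

section Counting

variable {p l ε : ℕ} [Fact p.Prime]

lemma ZMod.card_prime_dvd (hl : l ≠ 0) :
    Nat.card {x : ZMod (p ^ l) // (p : ZMod (p ^ l)) ∣ x} = p ^ (l - 1) := by
  have hp0 : 0 < p := (Fact.out : p.Prime).pos
  rw [ZMod.card_natCast_dvd (dvd_pow_self p hl)]
  obtain ⟨k, rfl⟩ := Nat.exists_eq_succ_of_ne_zero hl
  rw [Nat.succ_sub_one, pow_succ, Nat.mul_div_cancel _ hp0]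

lemma card_commutingMod (hres : ¬ IsSquare (ε : ZMod p)) {k : ℕ} (hk : k ≠ 0) (hkl : k ≤ l) :
    Nat.card (commutingMod (p ^ k) (rootMatrix (p ^ l) ε)) =
      ((p ^ l) ^ 2 - (p ^ (l - 1)) ^ 2) * (p ^ (l - k)) ^ 2 := by
  classical
  have hp0 : 0 < p := (Fact.out : p.Prime).pos
  have hl : l ≠ 0 := by omega
  have h := card_commutingMod_and hl hres (dvd_pow_self p hk) fun _ => True
  simp only [and_true] at h
  have hD := ZMod.card_prime_dvd (p := p) hl
  rw [Nat.card_eq_fintype_card, Fintype.card_subtype] at hD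
  have hc : Nat.card {c : ZMod (p ^ l) × ZMod (p ^ l) //
      ¬ ((p : ZMod (p ^ l)) ∣ c.1 ∧ (p : ZMod (p ^ l)) ∣ c.2)} =
      (p ^ l) ^ 2 - (p ^ (l - 1)) ^ 2 := by
    rw [Nat.card_eq_fintype_card, Fintype.card_subtype_compl, Fintype.card_prod, ZMod.card,
      Fintype.card_subtype, ← Finset.univ_product_univ,
      Finset.filter_product (fun x => (p : ZMod (p ^ l)) ∣ x) fun x => (p : ZMod (p ^ l)) ∣ x,
      Finset.card_product, hD, sq, sq]
  rw [hc, ZMod.card_natCast_dvd (pow_dvd_pow p hkl), Nat.pow_div hkl hp0] at h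
  exact h

lemma card_commutingCentralMod (hres : ¬ IsSquare (ε : ZMod p)) {k : ℕ} (hk : k ≠ 0)
    (hkl : k ≤ l) :
    Nat.card (commutingCentralMod (p ^ k) p (rootMatrix (p ^ l) ε)) =
      (p ^ l - p ^ (l - 1)) * p ^ (l - 1) * (p ^ (l - k)) ^ 2 := by
  classical
  have hp0 : 0 < p := (Fact.out : p.Prime).pos
  have hl : l ≠ 0 := by omega
  have h := card_commutingMod_and hl hres (dvd_pow_self p hk) fun x => (p : ZMod (p ^ l)) ∣ x
  simp only [← mem_commutingCentralMod_rootMatrix (dvd_pow_self p hk)] at h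
  have hD := ZMod.card_prime_dvd (p := p) hl
  rw [Nat.card_eq_fintype_card] at hD
  have hc : Nat.card {c : ZMod (p ^ l) × ZMod (p ^ l) //
      ¬ ((p : ZMod (p ^ l)) ∣ c.1 ∧ (p : ZMod (p ^ l)) ∣ c.2) ∧ (p : ZMod (p ^ l)) ∣ c.2} =
      (p ^ l - p ^ (l - 1)) * p ^ (l - 1) := by
    have hequiv : ∀ c : ZMod (p ^ l) × ZMod (p ^ l),
        (¬ ((p : ZMod (p ^ l)) ∣ c.1 ∧ (p : ZMod (p ^ l)) ∣ c.2) ∧ (p : ZMod (p ^ l)) ∣ c.2) ↔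
        ¬ (p : ZMod (p ^ l)) ∣ c.1 ∧ (p : ZMod (p ^ l)) ∣ c.2 := by
      intro c
      tauto
    simp_rw [hequiv]
    rw [Nat.card_eq_fintype_card, Fintype.card_subtype, ← Finset.univ_product_univ,
      Finset.filter_product (fun x => ¬ (p : ZMod (p ^ l)) ∣ x) fun x => (p : ZMod (p ^ l)) ∣ x,
      Finset.card_product, ← Fintype.card_subtype, ← Fintype.card_subtype,
      Fintype.card_subtype_compl, ZMod.card, hD]
  rw [hc, ZMod.card_natCast_dvd (pow_dvd_pow p hkl), Nat.pow_div hkl hp0] at h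
  exact h

end Counting

/-- Inner-product computations from the proof of Lemma 3.4: with `φ' = φ|_{N_{m+1}}`,
`⟨Ind_{N_{m+1}}^{T} φ', Ind_{N_{m+1}}^{T} φ'⟩_T = p²(p+1)`,
`⟨Ind_{N_{m+1}}^{T} φ', Ind_{L}^{T} φ⟩_T = p²`, and
`⟨Ind_{L}^{T} φ, Ind_{L}^{T} φ⟩_T = p`. -/
theorem lemma_3_4_inner_products (p m : ℕ) [Fact p.Prime] (hp : Odd p) (hm : 1 ≤ m)
    (ε : ℕ) (hε : ε < p ^ m) (hres : ¬ IsSquare (ε : ZMod p))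
    (φ : GL (Fin 2) (ZMod (p ^ (2 * m + 1))) → ℂ)
    (hφmul : ∀ X Y : GL (Fin 2) (ZMod (p ^ (2 * m + 1))),
      X ∈ TKS p (2 * m + 1) ε (m + 1) → Y ∈ TKS p (2 * m + 1) ε (m + 1) →
        φ (X * Y) = φ X * φ Y)
    (hφne : ∀ X ∈ TKS p (2 * m + 1) ε (m + 1), φ X ≠ 0)
    (hφK : ∀ X ∈ Kset p (2 * m + 1) (m + 1),
      φ X = phiA p (2 * m + 1)
        !![(0 : ZMod (p ^ (2 * m + 1))), (ε : ZMod (p ^ (2 * m + 1))); 1, 0] X)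
    (hφstab : ∀ t ∈ TKS p (2 * m + 1) ε m, ∀ X ∈ NsetOdd p (2 * m + 1) ε m,
      φ (t * X * t⁻¹) = φ X) :
    innerC (p ^ (2 * m + 1)) (TKS p (2 * m + 1) ε m)
        (indC (p ^ (2 * m + 1)) (NsetOdd p (2 * m + 1) ε m) (TKS p (2 * m + 1) ε m) φ)
        (indC (p ^ (2 * m + 1)) (NsetOdd p (2 * m + 1) ε m) (TKS p (2 * m + 1) ε m) φ)
      = (p : ℂ) ^ 2 * ((p : ℂ) + 1) ∧
    innerC (p ^ (2 * m + 1)) (TKS p (2 * m + 1) ε m)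
        (indC (p ^ (2 * m + 1)) (NsetOdd p (2 * m + 1) ε m) (TKS p (2 * m + 1) ε m) φ)
        (indC (p ^ (2 * m + 1)) (TKS p (2 * m + 1) ε (m + 1)) (TKS p (2 * m + 1) ε m) φ)
      = (p : ℂ) ^ 2 ∧
    innerC (p ^ (2 * m + 1)) (TKS p (2 * m + 1) ε m)
        (indC (p ^ (2 * m + 1)) (TKS p (2 * m + 1) ε (m + 1)) (TKS p (2 * m + 1) ε m) φ)
        (indC (p ^ (2 * m + 1)) (TKS p (2 * m + 1) ε (m + 1)) (TKS p (2 * m + 1) ε m) φ)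
      = (p : ℂ) := by
  have hpr : p.Prime := Fact.out
  have hl : 2 * m + 1 ≠ 0 := by omega
  have hεp : ¬ p ∣ ε := fun h => hres <| by
    rw [(ZMod.natCast_eq_zero_iff ε p).2 h]
    exact IsSquare.zero
  have hcop : Nat.Coprime (2 * ε) p := by
    rw [Nat.coprime_comm]
    exact (Nat.Coprime.symm (Nat.coprime_two_left.2 hp)).mul_right
      ((hpr.coprime_iff_not_dvd).2 hεp)
  have hT := TKS_eq hl hres (Nat.one_le_iff_ne_zero.1 hm)
  have hL := TKS_eq hl hres (Nat.add_one_ne_zero m)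
  have hA := NsetOdd_eq p (2 * m + 1) ε m
  rw [hL] at hφmul hφne ⊢
  rw [hT, hA] at hφstab ⊢
  have hmain := innerC_indC_of_stable (φ := φ)
    (A := commutingCentralMod (p ^ (m + 1)) p (rootMatrix (p ^ (2 * m + 1)) ε))
    (fun u hu => hu.1)
    (commutingMod_anti (pow_dvd_pow p (Nat.le_add_right m 1)) (rootMatrix (p ^ (2 * m + 1)) ε))
    (fun x hx y hy => hφmul x y hx hy) hφne
    (fun t ht u hu => conj_mem_commutingCentralMod (p := p) ht hu) hφstab ?_
  · obtain ⟨h1, h2, h3⟩ := hmain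
    have hp1 : (1 : ℕ) ≤ p := hpr.one_le
    have hcT : (Nat.card (commutingMod (p ^ m) (rootMatrix (p ^ (2 * m + 1)) ε)) : ℂ) =
        (p : ℂ) ^ (6 * m) * (p ^ 2 - 1) * p ^ 2 := by
      rw [card_commutingMod hres (by omega) (by omega), Nat.add_sub_cancel,
        show 2 * m + 1 - m = m + 1 by omega]
      push_cast [Nat.cast_sub (Nat.pow_le_pow_left (Nat.pow_le_pow_right hp1 (Nat.le_add_right _ 1)) 2)]
      ring
    have hcL : (Nat.card (commutingMod (p ^ (m + 1)) (rootMatrix (p ^ (2 * m + 1)) ε)) : ℂ) =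
        (p : ℂ) ^ (6 * m) * (p ^ 2 - 1) := by
      rw [card_commutingMod hres (by omega) (by omega), Nat.add_sub_cancel,
        show 2 * m + 1 - (m + 1) = m by omega]
      push_cast [Nat.cast_sub (Nat.pow_le_pow_left (Nat.pow_le_pow_right hp1 (Nat.le_add_right _ 1)) 2)]
      ring
    have hcA : (Nat.card (commutingCentralMod (p ^ (m + 1)) p (rootMatrix (p ^ (2 * m + 1)) ε)) : ℂ)
        = (p : ℂ) ^ (6 * m) * (p - 1) := by
      rw [card_commutingCentralMod hres (by omega) (by omega), Nat.add_sub_cancel,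
        show 2 * m + 1 - (m + 1) = m by omega]
      push_cast [Nat.cast_sub (Nat.pow_le_pow_right hp1 (Nat.le_add_right _ 1))]
      ring
    rw [hcT, hcL] at h2
    rw [hcT, hcL, hcA] at h3
    rw [hcT, hcA] at h1
    have hpC : (p : ℂ) ≠ 0 := by exact_mod_cast hpr.ne_zero
    have hp1C : (p : ℂ) - 1 ≠ 0 := sub_ne_zero.2 (by exact_mod_cast hpr.one_lt.ne')
    have hp2C : (p : ℂ) + 1 ≠ 0 := by exact_mod_cast p.succ_ne_zero
    have hfac : (p : ℂ) ^ 2 - 1 = (p - 1) * (p + 1) := by ring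
    rw [hfac] at h1 h2 h3
    refine ⟨h1.trans ?_, h2.trans ?_, h3.trans ?_⟩
    · field_simp
    · field_simp
    · field_simp
      ring
  · intro t ht u hu huA htu
    have hdvd : p ^ m * p ∣ p ^ (2 * m + 1) := by
      rw [← pow_succ]
      exact pow_dvd_pow p (by omega)
    refine mem_commutingMod_of_conj_mem (rootMatrix_mul_self _ ε)
      (dvd_pow_self p (Nat.one_le_iff_ne_zero.1 hm)) hcop (fun x hx => ?_) hu (fun C hC => ?_) ht htu
    · rw [Matrix.natCast_dvd_iff] at hx ⊢
      intro i j
      refine ZMod.natCast_dvd_of_mul_dvd (pow_ne_zero m hpr.ne_zero) hdvd ?_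
      have := hx i j
      rwa [← nsmul_eq_mul, Matrix.smul_apply, nsmul_eq_mul] at this
    · have hpm : p ∣ p ^ (m + 1) := dvd_pow_self p (by simp)
      have hunit : IsUnit (u.val 1 0) := by
        rw [ZMod.isUnit_iff_not_prime_dvd hl]
        exact fun h => huA ((mem_commutingCentralMod_rootMatrix hpm).2 ⟨hu, h⟩)
      have h := dvd_sub hC ((Nat.cast_dvd_cast hpm).trans
        (commutator_of_mem_commutingMod_rootMatrix hu C))
      rw [sub_sub_cancel, Matrix.natCast_dvd_iff] at h
      rw [Matrix.natCast_dvd_iff]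
      exact fun i j => hunit.dvd_mul_left.1 (h i j)
end
end
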